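/- For every prime p > 5, the number 2^3 · 5^{⌊(p−1)/4⌋} · p is a primitive covering number. -/

import Mathlib

/-- A positive integer `n` is a *covering number* if there is a finite system of
residue classes `aᵢ (mod mᵢ)` covering all of `ℤ`, whose moduli `mᵢ` are distinct,
all greater than `1`, and all divide `n`. -/
def IsCoveringNumber (n : ℕ) : Prop :=
  ∃ (k : ℕ) (a : Fin k → ℤ) (m : Fin k → ℕ),
    Function.Injective m ∧
    (∀ i, 1 < m i) ∧ (∀ i, m i ∣ n) ∧
    (∀ x : ℤ, ∃ i, (m i : ℤ) ∣ x - a i)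

/-- A covering number is *primitive* if none of its proper divisors is a covering number. -/
def IsPrimitiveCoveringNumber (n : ℕ) : Prop :=
  IsCoveringNumber n ∧ ∀ d : ℕ, d ∣ n → d ≠ n → ¬ IsCoveringNumber d

/-- A cover with distinct moduli amounts to a choice of one residue `r m` for every modulus `m`. -/
theorem isCoveringNumber_iff {n : ℕ} (hn : n ≠ 0) :
    IsCoveringNumber n ↔
      ∃ r : ℕ → ℤ, ∀ x : ℤ, ∃ m : ℕ, 1 < m ∧ m ∣ n ∧ (m : ℤ) ∣ x - r m := by
  constructor
  · rintro ⟨k, a, m, hinj, h1, hdvd, hcov⟩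
    refine ⟨Function.extend m a 0, fun x => ?_⟩
    obtain ⟨i, hi⟩ := hcov x
    exact ⟨m i, h1 i, hdvd i, by rwa [hinj.extend_apply]⟩
  · rintro ⟨r, hr⟩
    let s := n.divisors.filter (1 < ·)
    refine ⟨s.card, fun i => r (s.equivFin.symm i), fun i => (s.equivFin.symm i : ℕ),
      Subtype.val_injective.comp s.equivFin.symm.injective, fun i => ?_, fun i => ?_,
      fun x => ?_⟩
    · exact (Finset.mem_filter.mp (s.equivFin.symm i).2).2
    · exact Nat.dvd_of_mem_divisors (Finset.mem_filter.mp (s.equivFin.symm i).2).1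
    · obtain ⟨m, h1, hd, hm⟩ := hr x
      have hs : m ∈ s := Finset.mem_filter.mpr ⟨Nat.mem_divisors.mpr ⟨hd, hn⟩, h1⟩
      exact ⟨s.equivFin ⟨m, hs⟩, by simpa using hm⟩

theorem not_isCoveringNumber_one : ¬ IsCoveringNumber 1 := by
  rw [isCoveringNumber_iff one_ne_zero]
  rintro ⟨r, hr⟩
  obtain ⟨m, h1, hd, -⟩ := hr 0
  exact h1.ne' (Nat.dvd_one.mp hd)

theorem IsCoveringNumber.of_dvd {d n : ℕ} (h : IsCoveringNumber d) (hdn : d ∣ n) :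
    IsCoveringNumber n := by
  obtain ⟨k, a, m, hinj, h1, hdvd, hcov⟩ := h
  exact ⟨k, a, m, hinj, h1, fun i => (hdvd i).trans hdn, hcov⟩

theorem Nat.exists_eq_mul_pow_of_dvd_of_not_dvd {q m a d : ℕ} (hq : q.Prime)
    (hd : d ∣ m * q ^ (a + 1)) (hd' : ¬ d ∣ m * q ^ a) :
    ∃ e, e ∣ m ∧ d = e * q ^ (a + 1) := by
  obtain ⟨e, f, he, hf, rfl⟩ := Nat.dvd_mul.mp hd
  obtain ⟨b, hb, rfl⟩ := (Nat.dvd_prime_pow hq).mp hf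
  rcases hb.lt_or_eq with hlt | rfl
  · exact absurd (Nat.mul_dvd_mul he (pow_dvd_pow q (Nat.lt_succ_iff.mp hlt))) hd'
  · exact ⟨e, he, rfl⟩

/-- Fewer than `q` moduli divisible by the top power of a prime `q` are redundant in a cover. -/
theorem IsCoveringNumber.of_mul_prime_pow_succ {q m a : ℕ} (hq : q.Prime) (hqm : ¬ q ∣ m)
    (hcard : m.divisors.card < q) (h : IsCoveringNumber (m * q ^ (a + 1))) :
    IsCoveringNumber (m * q ^ a) := by
  have hm : m ≠ 0 := fun h0 => hqm (h0 ▸ dvd_zero q)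
  have hqa : ∀ b, q ^ b ≠ 0 := fun b => pow_ne_zero b hq.ne_zero
  rw [isCoveringNumber_iff (mul_ne_zero hm (hqa _))] at h ⊢
  obtain ⟨r, hr⟩ := h
  refine ⟨r, fun x => ?_⟩
  by_contra! hx
  have key : ∀ i : ℕ, ∃ e ∈ m.divisors,
      ((e * q ^ (a + 1) : ℕ) : ℤ) ∣ x + i * (m * q ^ a : ℕ) - r (e * q ^ (a + 1)) := by
    intro i
    obtain ⟨d, h1, hd, hdx⟩ := hr (x + i * (m * q ^ a : ℕ))
    have hd' : ¬ d ∣ m * q ^ a := by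
      intro hdd
      apply hx d h1 hdd
      have h2 : (d : ℤ) ∣ i * (m * q ^ a : ℕ) :=
        Dvd.dvd.mul_left (Int.natCast_dvd_natCast.mpr hdd) _
      have h3 := dvd_sub hdx h2
      rwa [show x + i * (m * q ^ a : ℕ) - r d - i * (m * q ^ a : ℕ) = x - r d by ring] at h3
    obtain ⟨e, he, rfl⟩ := Nat.exists_eq_mul_pow_of_dvd_of_not_dvd hq hd hd'
    exact ⟨e, Nat.mem_divisors.mpr ⟨he, hm⟩, hdx⟩
  choose e he hex using key
  obtain ⟨i, hi, j, hj, hij, heq⟩ := Finset.exists_ne_map_eq_of_card_lt_of_maps_to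
    (s := Finset.range q) (t := m.divisors) (by simpa using hcard) (fun i _ => he i)
  have hsub := dvd_sub (hex i) (heq ▸ hex j)
  have hpow : ((q : ℤ) ^ a * q) ∣ q ^ a * ((i - j) * m) := by
    refine Dvd.dvd.trans ⟨(e i : ℤ), ?_⟩ (hsub.trans (dvd_of_eq ?_))
    · push_cast; ring
    · push_cast; ring
  have hdvd : (q : ℤ) ∣ (i - j) * m :=
    Int.dvd_of_mul_dvd_mul_left (by exact_mod_cast hqa a) hpow
  rcases (Nat.prime_iff_prime_int.mp hq).dvd_or_dvd hdvd with h1 | h1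
  · have hlt : |(i : ℤ) - j| < q := by
      rw [Finset.mem_range] at hi hj
      rw [abs_lt]
      omega
    have := Int.eq_zero_of_abs_lt_dvd h1 hlt
    omega
  · exact hqm (Int.natCast_dvd_natCast.mp h1)

theorem IsCoveringNumber.of_mul_prime_pow {q m a : ℕ} (hq : q.Prime) (hqm : ¬ q ∣ m)
    (hcard : m.divisors.card < q) (h : IsCoveringNumber (m * q ^ a)) : IsCoveringNumber m := by
  induction a with
  | zero => simpa using h
  | succ a ih => exact ih (h.of_mul_prime_pow_succ hq hqm hcard)

/-- The divisors of `n` larger than `1` can serve as moduli covering all non-multiples of `n`. -/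
def CoversNonmultiples (n : ℕ) : Prop :=
  ∃ r : ℕ → ℤ, ∀ x : ℤ, ¬ (n : ℤ) ∣ x → ∃ m : ℕ, 1 < m ∧ m ∣ n ∧ (m : ℤ) ∣ x - r m

theorem coversNonmultiples_one : CoversNonmultiples 1 :=
  ⟨0, fun x hx => absurd (by simp) hx⟩

theorem Nat.exists_divisor_index {n : ℕ} :
    ∃ g : ℕ → ℕ, ∀ j < n.divisors.card, ∃ d ∈ n.divisors, g d = j := by
  refine ⟨fun d => if h : d ∈ n.divisors then n.divisors.equivFin ⟨d, h⟩ else 0,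
    fun j hj => ?_⟩
  exact ⟨n.divisors.equivFin.symm ⟨j, hj⟩, Subtype.prop _, by simp⟩

/-- The moduli `d * q ^ (a + 1)` with `d ∣ n` are new, and each of them covers one class of
multiples of `n * q ^ a` modulo `n * q ^ (a + 1)`. -/
theorem CoversNonmultiples.exists_extension {n q a : ℕ} (hq : q.Prime) (hqn : ¬ q ∣ n)
    (h : CoversNonmultiples (n * q ^ a)) :
    ∃ r : ℕ → ℤ, ∀ x : ℤ,
      (¬ ((n * q ^ a : ℕ) : ℤ) ∣ x ∨ ∃ j < n.divisors.card,
        ((n * q ^ (a + 1) : ℕ) : ℤ) ∣ x - (n * q ^ a : ℕ) * (j + 1)) →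
      ∃ m : ℕ, 1 < m ∧ m ∣ n * q ^ (a + 1) ∧ (m : ℤ) ∣ x - r m := by
  obtain ⟨r, hr⟩ := h
  obtain ⟨g, hg⟩ := Nat.exists_divisor_index (n := n)
  have hpos : 0 < q ^ (a + 1) := pow_pos hq.pos _
  refine ⟨fun m => if m ∣ n * q ^ a then r m
    else (n * q ^ a : ℕ) * (g (m / q ^ (a + 1)) + 1), fun x hx => ?_⟩
  rcases hx with hx | ⟨j, hj, hx⟩
  · obtain ⟨m, h1, hd, hm⟩ := hr x hx
    exact ⟨m, h1, hd.trans (Nat.mul_dvd_mul_left n (pow_dvd_pow q a.le_succ)), by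
      simpa only [if_pos hd] using hm⟩
  · obtain ⟨d, hd, rfl⟩ := hg j hj
    have hdn := Nat.dvd_of_mem_divisors hd
    have hd0 : 0 < d := Nat.pos_of_mem_divisors hd
    have hnew : ¬ d * q ^ (a + 1) ∣ n * q ^ a := by
      intro hdvd
      have h2 : q ^ a * q ∣ q ^ a * n := by
        rw [← pow_succ, mul_comm _ n]
        exact (Dvd.intro_left d rfl).trans hdvd
      exact hqn (Nat.dvd_of_mul_dvd_mul_left (pow_pos hq.pos a) h2)
    refine ⟨d * q ^ (a + 1), ?_, Nat.mul_dvd_mul_right hdn _, ?_⟩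
    · exact lt_of_lt_of_le (Nat.one_lt_pow a.succ_ne_zero hq.one_lt)
        (Nat.le_mul_of_pos_left _ hd0)
    · simp only [if_neg hnew, Nat.mul_div_cancel d hpos]
      exact (Int.natCast_dvd_natCast.mpr (Nat.mul_dvd_mul_right hdn _)).trans hx

theorem Int.natCast_mul_pow_succ_dvd_sub {n q a : ℕ} {t j : ℤ} (h : (q : ℤ) ∣ t - j) :
    ((n * q ^ (a + 1) : ℕ) : ℤ) ∣ (n * q ^ a : ℕ) * t - (n * q ^ a : ℕ) * j := by
  rw [← mul_sub, pow_succ, ← mul_assoc, Nat.cast_mul]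
  exact mul_dvd_mul_left _ h

theorem CoversNonmultiples.mul_prime_pow_succ {n q a : ℕ} (hq : q.Prime) (hqn : ¬ q ∣ n)
    (hcard : q - 1 ≤ n.divisors.card) (h : CoversNonmultiples (n * q ^ a)) :
    CoversNonmultiples (n * q ^ (a + 1)) := by
  obtain ⟨r, hr⟩ := h.exists_extension hq hqn
  refine ⟨r, fun x hx => hr x ?_⟩
  by_cases hdx : ((n * q ^ a : ℕ) : ℤ) ∣ x
  · right
    obtain ⟨t, rfl⟩ := hdx
    have hq0 : (0 : ℤ) < q := by exact_mod_cast hq.pos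
    have hne : t % q ≠ 0 := by
      intro h0
      apply hx
      have := Int.natCast_mul_pow_succ_dvd_sub (n := n) (a := a) (j := 0)
        (by simpa using Int.dvd_of_emod_eq_zero h0)
      simpa using this
    have h1 := Int.emod_nonneg t hq0.ne'
    have h2 := Int.emod_lt_of_pos t hq0
    refine ⟨(t % q).toNat - 1, by omega, Int.natCast_mul_pow_succ_dvd_sub ?_⟩
    have h3 : (((t % q).toNat - 1 : ℕ) : ℤ) + 1 = t % q := by omega
    rw [h3]
    exact Int.dvd_self_sub_emod
  · exact Or.inl hdx

theorem CoversNonmultiples.mul_prime_pow {n q : ℕ} (a : ℕ) (hq : q.Prime) (hqn : ¬ q ∣ n)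
    (hcard : q - 1 ≤ n.divisors.card) (h : CoversNonmultiples n) :
    CoversNonmultiples (n * q ^ a) := by
  induction a with
  | zero => simpa using h
  | succ a ih => exact ih.mul_prime_pow_succ hq hqn hcard

theorem CoversNonmultiples.isCoveringNumber_mul_prime {n q : ℕ} (hq : q.Prime) (hqn : ¬ q ∣ n)
    (hcard : q ≤ n.divisors.card) (h : CoversNonmultiples n) : IsCoveringNumber (n * q) := by
  have hn : n ≠ 0 := fun h0 => hqn (h0 ▸ dvd_zero q)
  obtain ⟨r, hr⟩ := CoversNonmultiples.exists_extension (a := 0) hq hqn (by simpa using h)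
  rw [isCoveringNumber_iff (mul_ne_zero hn hq.ne_zero)]
  refine ⟨r, fun x => ?_⟩
  rw [← pow_one q]
  refine hr x ?_
  by_cases hdx : ((n * q ^ 0 : ℕ) : ℤ) ∣ x
  · right
    obtain ⟨t, rfl⟩ := hdx
    have hq0 : (0 : ℤ) < q := by exact_mod_cast hq.pos
    have h1 := Int.emod_nonneg (t - 1) hq0.ne'
    have h2 := Int.emod_lt_of_pos (t - 1) hq0
    refine ⟨((t - 1) % q).toNat, by omega, Int.natCast_mul_pow_succ_dvd_sub ?_⟩
    rw [Int.toNat_of_nonneg h1, add_comm, ← sub_sub]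
    exact Int.dvd_self_sub_emod
  · exact Or.inl hdx

theorem Nat.card_divisors_two_pow_mul_five_pow (a b : ℕ) :
    (2 ^ a * 5 ^ b).divisors.card = (a + 1) * (b + 1) := by
  have hcop : Nat.Coprime (2 ^ a) (5 ^ b) := Nat.Coprime.pow a b (by norm_num)
  rw [hcop.card_divisors_mul, Nat.divisors_prime_pow Nat.prime_two,
    Nat.divisors_prime_pow Nat.prime_five]
  simp

theorem Nat.Prime.not_dvd_two_pow_mul_five_pow {p : ℕ} (hp : p.Prime) (h5 : 5 < p) (a b : ℕ) :
    ¬ p ∣ 2 ^ a * 5 ^ b := by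
  intro h
  rcases hp.dvd_mul.mp h with h | h
  · have := Nat.le_of_dvd (by norm_num) (hp.dvd_of_dvd_pow h)
    omega
  · have := Nat.le_of_dvd (by norm_num) (hp.dvd_of_dvd_pow h)
    omega

theorem not_five_dvd_two_pow (a : ℕ) : ¬ 5 ∣ 2 ^ a := fun h =>
  absurd (Nat.prime_five.dvd_of_dvd_pow h) (by norm_num)

theorem not_isCoveringNumber_two_pow_mul_five_pow {a : ℕ} (ha : a ≤ 3) (b : ℕ) :
    ¬ IsCoveringNumber (2 ^ a * 5 ^ b) := by
  intro h
  have h2 : IsCoveringNumber (2 ^ a) := by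
    refine h.of_mul_prime_pow Nat.prime_five (not_five_dvd_two_pow a) ?_
    rw [Nat.divisors_prime_pow Nat.prime_two]
    simp only [Finset.card_map, Finset.card_range]
    omega
  rw [← one_mul (2 ^ a)] at h2
  exact not_isCoveringNumber_one (h2.of_mul_prime_pow Nat.prime_two (by norm_num) (by simp))

theorem not_isCoveringNumber_two_pow_mul_five_pow_mul_prime {p a b : ℕ} (hp : p.Prime)
    (h5 : 5 < p) (ha : a ≤ 3) (hcard : (a + 1) * (b + 1) < p) :
    ¬ IsCoveringNumber (2 ^ a * 5 ^ b * p) := by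
  intro h
  rw [← pow_one p] at h
  exact not_isCoveringNumber_two_pow_mul_five_pow ha b
    (h.of_mul_prime_pow hp (hp.not_dvd_two_pow_mul_five_pow h5 a b)
      (by rwa [Nat.card_divisors_two_pow_mul_five_pow]))

theorem stmt8 (p : ℕ) (hp : p.Prime) (h5 : 5 < p) :
    IsPrimitiveCoveringNumber (2 ^ 3 * 5 ^ ((p - 1) / 4) * p) := by
  have hodd : p % 2 = 1 := hp.eq_two_or_odd.resolve_left (by omega)
  have h9 : p ≠ 9 := by
    rintro rfl
    exact absurd hp (by norm_num)
  obtain ⟨k, hk⟩ : ∃ k, (p - 1) / 4 = k + 1 := ⟨(p - 1) / 4 - 1, by omega⟩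
  rw [hk]
  constructor
  · refine CoversNonmultiples.isCoveringNumber_mul_prime hp
      (hp.not_dvd_two_pow_mul_five_pow h5 _ _) ?_ ?_
    · rw [Nat.card_divisors_two_pow_mul_five_pow]
      omega
    · refine CoversNonmultiples.mul_prime_pow _ Nat.prime_five (not_five_dvd_two_pow 3) ?_ ?_
      · rw [Nat.divisors_prime_pow Nat.prime_two]
        simp
      · rw [← one_mul (2 ^ 3)]
        exact coversNonmultiples_one.mul_prime_pow 3 Nat.prime_two (by norm_num) (by simp)
  · intro d hd hne hcov
    obtain ⟨y, z, hy, hz, rfl⟩ := Nat.dvd_mul.mp hd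
    obtain ⟨u, v, hu, hv, rfl⟩ := Nat.dvd_mul.mp hy
    obtain ⟨a, ha, rfl⟩ := (Nat.dvd_prime_pow Nat.prime_two).mp hu
    obtain ⟨b, hb, rfl⟩ := (Nat.dvd_prime_pow Nat.prime_five).mp hv
    rcases (Nat.dvd_prime hp).mp hz with rfl | rfl
    · rw [mul_one] at hcov
      exact not_isCoveringNumber_two_pow_mul_five_pow ha b hcov
    · rcases ha.lt_or_eq with ha' | rfl
      · refine not_isCoveringNumber_two_pow_mul_five_pow_mul_prime hp h5 ha ?_ hcov
        calc (a + 1) * (b + 1) ≤ 3 * (k + 1 + 1) := Nat.mul_le_mul (by omega) (by omega)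
          _ < z := by omega
      · have hb' : b < k + 1 := hb.lt_of_ne fun h => hne (by rw [h])
        exact not_isCoveringNumber_two_pow_mul_five_pow_mul_prime hp h5 ha (by omega) hcov
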